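/- arXiv:2210.02562 — 2 statements merged into one kernel-verified Lean document; each statement's English description precedes it below -/
import Mathlib

section
/- (One-step progress for a linear transfer function.) Let 𝒟 ⊆ ℝ^d be convex, closed and bounded, let f : 𝒟 → ℝ be convex and β-smooth, and let w* be a minimizer of f over 𝒟. Let ρ(x) = c_ρ·x with c_ρ > 0, and assume |ρ(f(x) − f(y))| ≤ 1 for all x, y in (a suitable neighborhood of) 𝒟 so that the feedback is a valid signed Bernoulli. Fix ε > 0, set γ = √(ε/(2β)) and η = c_ρ·ε^{3/2}/(d·√(2β)). Suppose w_t ∈ 𝒟 satisfies f(w_t) − f(w*) > ε. Let u be uniform on the unit sphere S^{d−1}, let o ∈ {±1} be a random sign with E[o | u] = c_ρ·(f(w_t + γu) − f(w_t − γu)), and set w_{t+1} := Π_𝒟(w_t − η·o·u). Then E[‖w_{t+1} − w*‖²] ≤ ‖w_t − w*‖² − c_ρ²·ε³/(2β·d²). -/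
open MeasureTheory ProbabilityTheory
open scoped RealInnerProductSpace

/-- A measurable function bounded on the unit sphere is integrable for a finite measure carried
by the sphere. -/
theorem integrable_of_bounded_on_sphere {E : Type*} [NormedAddCommGroup E]
    [MeasurableSpace E] {μ : Measure E} [IsFiniteMeasure μ]
    (hsph : ∀ᵐ x ∂μ, ‖x‖ = 1) {F : E → ℝ} (hF : Measurable F) {C : ℝ}
    (hC : ∀ x, ‖x‖ = 1 → |F x| ≤ C) : Integrable F μ :=
  Integrable.of_bound hF.aestronglyMeasurable C (hsph.mono fun x hx => hC x hx)

/-- The gradient of a differentiable convex function is bounded on bounded sets. -/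
theorem exists_bound_gradient_of_convex {E : Type*} [NormedAddCommGroup E]
    [InnerProductSpace ℝ E] [FiniteDimensional ℝ E] {f : E → ℝ} (hf : Continuous f) {g : E → E}
    (hconv : ∀ x y, ⟪g x, y - x⟫ ≤ f y - f x) (R : ℝ) :
    ∃ C, 0 ≤ C ∧ ∀ x, ‖x‖ ≤ R → |f x| ≤ C ∧ ‖g x‖ ≤ C := by
  obtain ⟨M, hM⟩ := (isCompact_closedBall (0 : E) (R + 1)).exists_bound_of_continuousOn
    hf.continuousOn
  refine ⟨2 * |M|, by positivity, fun x hx => ?_⟩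
  have hfx : |f x| ≤ M := hM x (by simp; linarith)
  have hMabs := le_abs_self M
  refine ⟨by linarith [abs_nonneg M], ?_⟩
  rcases eq_or_ne (g x) 0 with h0 | h0
  · rw [h0, norm_zero]; positivity
  have hpos := norm_pos_iff.2 h0
  have hy : ‖x + ‖g x‖⁻¹ • g x‖ ≤ R + 1 := by
    refine (norm_add_le _ _).trans (add_le_add hx ?_)
    rw [norm_smul, norm_inv, norm_norm, inv_mul_cancel₀ hpos.ne']
  have hfy : |f (x + ‖g x‖⁻¹ • g x)| ≤ M := hM _ (by simpa using hy)
  have h := hconv x (x + ‖g x‖⁻¹ • g x)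
  rw [add_sub_cancel_left, inner_smul_right, real_inner_self_eq_norm_sq, pow_two,
    inv_mul_cancel_left₀ hpos.ne'] at h
  linarith [abs_le.1 hfx, abs_le.1 hfy]

section Sphere

variable {E : Type*} [NormedAddCommGroup E] [InnerProductSpace ℝ E] [FiniteDimensional ℝ E]
  [MeasurableSpace E] [BorelSpace E]

/-- The linear functionals have mean zero under a rotation-invariant measure. -/
theorem integral_inner_eq_zero_of_rotation_invariant {μ : Measure E}
    (hrot : ∀ T : E ≃ₗᵢ[ℝ] E, Measure.map (⇑T) μ = μ) (v : E) : ∫ x, ⟪x, v⟫ ∂μ = 0 := by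
  have h : ∫ x, ⟪x, v⟫ ∂μ = ∫ x, ⟪-x, v⟫ ∂μ := by
    conv_lhs => rw [← hrot (LinearIsometryEquiv.neg ℝ)]
    rw [integral_map (LinearIsometryEquiv.continuous _).aemeasurable
      (by fun_prop)]
    simp
  simp only [inner_neg_left, integral_neg] at h
  linarith

/-- Infinitesimal rotation invariance: the derivative of a function along a skew-symmetric linear
vector field has mean zero. -/
theorem integral_fderiv_skew_eq_zero {μ : Measure E} [IsFiniteMeasure μ]
    (hsph : ∀ᵐ x ∂μ, ‖x‖ = 1) (hrot : ∀ T : E ≃ₗᵢ[ℝ] E, Measure.map (⇑T) μ = μ)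
    {k : E → ℝ} {k' : E → E →L[ℝ] ℝ} (hk : ∀ x, HasFDerivAt k (k' x) x) {C : ℝ}
    (hC : ∀ x, ‖x‖ = 1 → ‖k' x‖ ≤ C) {A : E →L[ℝ] E} (hA : A ∈ skewAdjoint (E →L[ℝ] E)) :
    ∫ x, k' x (A x) ∂μ = 0 := by
  let : NormedAlgebra ℚ (E →L[ℝ] E) := NormedAlgebra.restrictScalars ℚ ℝ _
  have hkc : Continuous k := continuous_iff_continuousAt.2 fun x => (hk x).continuousAt
  have hk'm : Measurable k' := by
    rw [← funext fun x => (hk x).fderiv]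
    exact measurable_fderiv ℝ k
  have hmem : ∀ θ : ℝ, NormedSpace.exp (θ • A) ∈ unitary (E →L[ℝ] E) := fun θ =>
    NormedSpace.exp_mem_unitary_of_mem_skewAdjoint (skewAdjoint.smul_mem θ hA)
  have hnorm : ∀ (θ : ℝ) x, ‖NormedSpace.exp (θ • A) x‖ = ‖x‖ := fun θ x =>
    Unitary.norm_map ⟨_, hmem θ⟩ x
  have hm : Measurable fun x => k' x (A x) :=
    isBoundedBilinearMap_apply.continuous.measurable.comp (hk'm.prodMk A.continuous.measurable)
  obtain ⟨M, hM⟩ := (isCompact_sphere (0 : E) 1).exists_bound_of_continuousOn hkc.continuousOn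
  have hkint : Integrable k μ := integrable_of_bounded_on_sphere hsph hkc.measurable
    fun x hx => hM x (by simpa using hx)
  have key := (hasDerivAt_integral_of_dominated_loc_of_deriv_le (μ := μ) (s := Set.univ)
    (F := fun (θ : ℝ) x => k (NormedSpace.exp (θ • A) x)) (x₀ := (0 : ℝ))
    (F' := fun θ x => k' (NormedSpace.exp (θ • A) x) (A (NormedSpace.exp (θ • A) x)))
    (bound := fun _ => C * ‖A‖) Filter.univ_mem
    (.of_forall fun θ => (hkc.comp (NormedSpace.exp (θ • A)).continuous).aestronglyMeasurable)
    (by simpa using hkint)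
    (by simpa using hm.aestronglyMeasurable)
    (hsph.mono fun x hx θ _ => by
      have h1 : ‖NormedSpace.exp (θ • A) x‖ = 1 := by rw [hnorm, hx]
      calc _ ≤ ‖k' (NormedSpace.exp (θ • A) x)‖ * ‖A (NormedSpace.exp (θ • A) x)‖ :=
            ContinuousLinearMap.le_opNorm _ _
        _ ≤ C * ‖A‖ := by
          gcongr
          · exact (norm_nonneg _).trans (hC _ h1)
          · exact hC _ h1
          · simpa [h1] using A.le_opNorm (NormedSpace.exp (θ • A) x))
    (integrable_const _)
    (.of_forall fun x θ _ => by
      have h := (hasDerivAt_exp_smul_const' A θ).clm_apply (hasDerivAt_const θ x)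
      have := (hk (NormedSpace.exp (θ • A) x)).comp_hasDerivAt θ h
      simpa [Function.comp_def] using this)).2
  have hconst : (fun θ : ℝ => ∫ x, k (NormedSpace.exp (θ • A) x) ∂μ) = fun _ => ∫ x, k x ∂μ := by
    funext θ
    conv_rhs => rw [← hrot (Unitary.linearIsometryEquiv ⟨_, hmem θ⟩)]
    rw [integral_map (LinearIsometryEquiv.continuous _).aemeasurable hkc.aestronglyMeasurable]
    rfl
  rw [hconst] at key
  simpa using key.unique (hasDerivAt_const _ _)

/-- The gradient of a differentiable function is measurable. -/
theorem measurable_of_hasGradientAt {f : E → ℝ} {g : E → E}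
    (hdiff : ∀ x, HasGradientAt f (g x) x) : Measurable g := by
  have h : g = fun x => (InnerProductSpace.toDual ℝ E).symm (fderiv ℝ f x) := by
    funext x
    rw [(hdiff x).hasFDerivAt.fderiv, LinearIsometryEquiv.symm_apply_apply]
  rw [h]
  exact (LinearIsometryEquiv.continuous _).measurable.comp (measurable_fderiv ℝ f)

/-- The weighted spherical mean `r ↦ ∫ f (w + r x) ⟪x, v⟫` is differentiable. -/
theorem hasDerivAt_integral_sphere_mul_inner {μ : Measure E} [IsFiniteMeasure μ]
    (hsph : ∀ᵐ x ∂μ, ‖x‖ = 1) {f : E → ℝ} {g : E → E} (hdiff : ∀ x, HasGradientAt f (g x) x)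
    (hconv : ∀ x y, ⟪g x, y - x⟫ ≤ f y - f x) (w v : E) (r : ℝ) :
    HasDerivAt (fun r : ℝ => ∫ x, f (w + r • x) * ⟪x, v⟫ ∂μ)
      (∫ x, ⟪g (w + r • x), x⟫ * ⟪x, v⟫ ∂μ) r := by
  have hfc : Continuous f := continuous_iff_continuousAt.2 fun x => (hdiff x).continuousAt
  have hgm := measurable_of_hasGradientAt hdiff
  obtain ⟨C, hC0, hC⟩ := exists_bound_gradient_of_convex hfc hconv (‖w‖ + (|r| + 1))
  have hball : ∀ s ∈ Metric.ball r 1, ∀ x : E, ‖x‖ = 1 → ‖w + s • x‖ ≤ ‖w‖ + (|r| + 1) := by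
    intro s hs x hx
    refine (norm_add_le _ _).trans (add_le_add le_rfl ?_)
    rw [norm_smul, hx, mul_one, Real.norm_eq_abs]
    have := abs_sub_abs_le_abs_sub s r
    rw [Metric.mem_ball, Real.dist_eq] at hs
    linarith
  have hinner : ∀ a x : E, ‖x‖ = 1 → |⟪a, x⟫| ≤ ‖a‖ := fun a x hx => by
    simpa [hx] using abs_real_inner_le_norm a x
  refine (hasDerivAt_integral_of_dominated_loc_of_deriv_le (μ := μ)
    (F := fun (r : ℝ) x => f (w + r • x) * ⟪x, v⟫)
    (F' := fun (r : ℝ) x => ⟪g (w + r • x), x⟫ * ⟪x, v⟫)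
    (bound := fun _ => C * ‖v‖) (Metric.ball_mem_nhds r one_pos)
    (.of_forall fun s => ?_) ?_ ?_ (hsph.mono fun x hx s hs => ?_) (integrable_const _)
    (.of_forall fun x s _ => ?_)).2
  · exact Continuous.aestronglyMeasurable (by fun_prop)
  · refine integrable_of_bounded_on_sphere hsph (Continuous.measurable (by fun_prop))
      (C := C * ‖v‖) fun x hx => ?_
    rw [abs_mul, real_inner_comm]
    gcongr
    · exact (hC _ (hball r (Metric.mem_ball_self one_pos) x hx)).1
    · exact hinner v x hx
  · exact Measurable.aestronglyMeasurable (by fun_prop)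
  · rw [norm_mul, Real.norm_eq_abs, Real.norm_eq_abs, real_inner_comm v x]
    gcongr
    · exact (hinner _ x hx).trans (hC _ (hball s hs x hx)).2
    · exact hinner v x hx
  · have h1 : HasDerivAt (fun s : ℝ => w + s • x) x s := by
      simpa using ((hasDerivAt_id s).smul_const x).const_add w
    have h2 := (hdiff (w + s • x)).hasFDerivAt.comp_hasDerivAt s h1
    simpa [Function.comp_def] using h2.mul_const ⟪x, v⟫

/-- Integration by parts on the sphere: the tangential part of the divergence theorem. -/
theorem finrank_sub_one_mul_integral_sphere {μ : Measure E} [IsFiniteMeasure μ]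
    (hsph : ∀ᵐ x ∂μ, ‖x‖ = 1) (hrot : ∀ T : E ≃ₗᵢ[ℝ] E, Measure.map (⇑T) μ = μ)
    {f : E → ℝ} {g : E → E} (hdiff : ∀ x, HasGradientAt f (g x) x)
    (hconv : ∀ x y, ⟪g x, y - x⟫ ≤ f y - f x) (w v : E) (r : ℝ) :
    ((Module.finrank ℝ E : ℝ) - 1) * ∫ x, f (w + r • x) * ⟪x, v⟫ ∂μ =
      r * ∫ x, ⟪g (w + r • x), v⟫ ∂μ - r * ∫ x, ⟪g (w + r • x), x⟫ * ⟪x, v⟫ ∂μ := by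
  have hfc : Continuous f := continuous_iff_continuousAt.2 fun x => (hdiff x).continuousAt
  have hgm := measurable_of_hasGradientAt hdiff
  obtain ⟨C, hC0, hC⟩ := exists_bound_gradient_of_convex hfc hconv (‖w‖ + |r|)
  have hball : ∀ x : E, ‖x‖ = 1 → ‖w + r • x‖ ≤ ‖w‖ + |r| := by
    intro x hx
    refine (norm_add_le _ _).trans (add_le_add le_rfl ?_)
    rw [norm_smul, hx, mul_one, Real.norm_eq_abs]
  have hinner : ∀ a x : E, ‖x‖ = 1 → |⟪a, x⟫| ≤ ‖a‖ := fun a x hx => by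
    simpa [hx] using abs_real_inner_le_norm a x
  have hI1 : Integrable (fun x => f (w + r • x) * ⟪x, v⟫) μ := by
    refine integrable_of_bounded_on_sphere hsph (Continuous.measurable (by fun_prop))
      (C := C * ‖v‖) fun x hx => ?_
    rw [abs_mul, real_inner_comm]
    gcongr
    · exact (hC _ (hball x hx)).1
    · exact hinner v x hx
  have hI2 : Integrable (fun x => ⟪g (w + r • x), v⟫) μ := by
    refine integrable_of_bounded_on_sphere hsph (by fun_prop) (C := C * ‖v‖) fun x hx => ?_
    refine (abs_real_inner_le_norm _ _).trans ?_
    gcongr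
    exact (hC _ (hball x hx)).2
  have hI3 : Integrable (fun x => ⟪g (w + r • x), x⟫ * ⟪x, v⟫) μ := by
    refine integrable_of_bounded_on_sphere hsph (by fun_prop) (C := C * ‖v‖) fun x hx => ?_
    rw [abs_mul, real_inner_comm v x]
    gcongr
    · exact (hinner _ x hx).trans (hC _ (hball x hx)).2
    · exact hinner v x hx
  let b := stdOrthonormalBasis ℝ E
  let A : Fin (Module.finrank ℝ E) → E →L[ℝ] E := fun i =>
    (innerSL ℝ v).smulRight (b i) - (innerSL ℝ (b i)).smulRight v
  have hAapp : ∀ i x, A i x = ⟪v, x⟫ • b i - ⟪b i, x⟫ • v := fun i x => by simp [A]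
  have hA : ∀ i, A i ∈ skewAdjoint (E →L[ℝ] E) := by
    intro i
    rw [skewAdjoint.mem_iff, ContinuousLinearMap.star_eq_adjoint]
    refine ((ContinuousLinearMap.eq_adjoint_iff _ _).2 fun x y => ?_).symm
    rw [neg_apply, hAapp, hAapp]
    simp only [inner_neg_left, inner_sub_left, inner_sub_right, real_inner_smul_left,
      real_inner_smul_right, real_inner_comm x v, real_inner_comm x (b i)]
    ring
  let k' : Fin (Module.finrank ℝ E) → E → E →L[ℝ] ℝ := fun i x =>
    f (w + r • x) • innerSL ℝ (b i) + ⟪b i, x⟫ • (r • innerSL ℝ (g (w + r • x)))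
  have hk : ∀ i x, HasFDerivAt (fun x => f (w + r • x) * ⟪b i, x⟫) (k' i x) x := by
    intro i x
    have h1 : HasFDerivAt (fun x : E => w + r • x) (r • ContinuousLinearMap.id ℝ E) x :=
      ((hasFDerivAt_id x).const_smul r).const_add w
    have h2 := ((hdiff (w + r • x)).hasFDerivAt.comp x h1).mul
      (innerSL ℝ (b i)).hasFDerivAt
    refine h2.congr_fderiv ?_
    ext y
    simp [k']
  have hk'b : ∀ i x, ‖x‖ = 1 → ‖k' i x‖ ≤ C + |r| * C := by
    intro i x hx
    have hb : ‖b i‖ = 1 := b.orthonormal.1 i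
    refine (norm_add_le _ _).trans (add_le_add ?_ ?_)
    · rw [norm_smul, innerSL_apply_norm, hb, mul_one]
      exact (hC _ (hball x hx)).1
    · rw [norm_smul, norm_smul, innerSL_apply_norm]
      have h1 : ‖⟪b i, x⟫‖ ≤ 1 := by simpa [hb] using hinner (b i) x hx
      have h2 := (hC _ (hball x hx)).2
      calc _ ≤ 1 * (|r| * C) := by gcongr; exact le_of_eq (Real.norm_eq_abs r)
        _ = _ := one_mul _
  have hint : ∀ i, Integrable (fun x => k' i x (A i x)) μ := by
    intro i
    refine integrable_of_bounded_on_sphere hsph ?_ (C := (C + |r| * C) * ‖A i‖) fun x hx => ?_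
    · simp only [k', hAapp]
      simp only [add_apply, smul_apply,
        innerSL_apply_apply, smul_eq_mul]
      fun_prop
    · refine ((k' i x).le_opNorm _).trans ?_
      gcongr
      · exact hk'b i x hx
      · simpa [hx] using (A i).le_opNorm x
  have hzero : ∫ x, ∑ i, k' i x (A i x) ∂μ = 0 := by
    rw [integral_finsetSum _ fun i _ => hint i]
    exact Finset.sum_eq_zero fun i _ =>
      integral_fderiv_skew_eq_zero hsph hrot (hk i) (hk'b i) (hA i)
  have hpt : ∀ᵐ x ∂μ, ∑ i, k' i x (A i x) =
      ((Module.finrank ℝ E : ℝ) - 1) * (f (w + r • x) * ⟪x, v⟫)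
        - (r * ⟪g (w + r • x), v⟫ - r * (⟪g (w + r • x), x⟫ * ⟪x, v⟫)) := by
    filter_upwards [hsph] with x hx
    have hterm : ∀ i, k' i x (A i x) =
        f (w + r • x) * ⟪x, v⟫ - f (w + r • x) * (⟪v, b i⟫ * ⟪b i, x⟫)
          + r * ⟪x, v⟫ * (⟪g (w + r • x), b i⟫ * ⟪b i, x⟫)
          - r * ⟪g (w + r • x), v⟫ * ⟪b i, x⟫ ^ 2 := by
      intro i
      have hb : ⟪b i, b i⟫ = 1 := by
        rw [real_inner_self_eq_norm_sq, b.orthonormal.1 i, one_pow]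
      rw [hAapp]
      simp only [k', add_apply, smul_apply,
        innerSL_apply_apply, smul_eq_mul, inner_sub_right, real_inner_smul_right, hb,
        real_inner_comm x v, real_inner_comm v (b i)]
      ring
    simp only [hterm, Finset.sum_sub_distrib, Finset.sum_add_distrib, ← Finset.mul_sum,
      b.sum_inner_mul_inner, b.sum_sq_inner_right, hx, real_inner_comm x v]
    simp
    ring
  rw [integral_congr_ae hpt, integral_sub (hI1.const_mul _)
    (by exact (hI2.const_mul _).sub (hI3.const_mul _)), integral_sub (hI2.const_mul _) (hI3.const_mul _),
    integral_const_mul, integral_const_mul, integral_const_mul] at hzero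
  linarith

/-- Lower bound on the spherical mean of `f (w + γ x) ⟪x, w - z⟫` for a convex and `β`-smooth
function `f`: the spherical gradient estimator correlates with the direction `w - z`. -/
theorem le_integral_sphere_mul_inner {μ : Measure E} [IsProbabilityMeasure μ]
    (hsph : ∀ᵐ x ∂μ, ‖x‖ = 1) (hrot : ∀ T : E ≃ₗᵢ[ℝ] E, Measure.map (⇑T) μ = μ)
    {f : E → ℝ} {g : E → E} (hdiff : ∀ x, HasGradientAt f (g x) x)
    (hconv : ∀ x y, ⟪g x, y - x⟫ ≤ f y - f x) {β : ℝ} (hβ : 0 ≤ β)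
    (hsmooth : ∀ x y, f y ≤ f x + ⟪g x, y - x⟫ + β / 2 * ‖y - x‖ ^ 2)
    (hdim : 0 < Module.finrank ℝ E) (w z : E) {γ c : ℝ} (hγ : 0 < γ)
    (hc : c ≤ f w - f z - β / 2 * γ ^ 2) :
    c * γ / Module.finrank ℝ E ≤ ∫ x, f (w + γ • x) * ⟪x, w - z⟫ ∂μ := by
  have hfc : Continuous f := continuous_iff_continuousAt.2 fun x => (hdiff x).continuousAt
  have hgm := measurable_of_hasGradientAt hdiff
  have hmean : ∀ r, 0 ≤ r → r ≤ γ → c ≤ ∫ x, ⟪g (w + r • x), w - z⟫ ∂μ := by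
    intro r hr hrγ
    obtain ⟨C, -, hC⟩ := exists_bound_gradient_of_convex hfc hconv (‖w‖ + |r|)
    have hI2 : Integrable (fun x => ⟪g (w + r • x), w - z⟫) μ := by
      refine integrable_of_bounded_on_sphere hsph (by fun_prop) (C := C * ‖w - z‖) fun x hx => ?_
      refine (abs_real_inner_le_norm _ _).trans ?_
      gcongr
      refine (hC _ ((norm_add_le _ _).trans (add_le_add le_rfl ?_))).2
      rw [norm_smul, hx, mul_one, Real.norm_eq_abs]
    have hI4 : Integrable (fun x => ⟪x, g w - g z⟫) μ := by
      refine integrable_of_bounded_on_sphere hsph (by fun_prop) (C := ‖g w - g z‖) fun x hx => ?_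
      simpa [hx] using abs_real_inner_le_norm x (g w - g z)
    calc c ≤ ∫ x, (c + r * ⟪x, g w - g z⟫) ∂μ := by
          rw [integral_add (integrable_const _) (hI4.const_mul r), integral_const_mul,
            integral_inner_eq_zero_of_rotation_invariant hrot]
          simp
      _ ≤ _ := by
          refine integral_mono_ae ((integrable_const _).add (hI4.const_mul r)) hI2 ?_
          filter_upwards [hsph] with x hx
          have h1 := hconv (w + r • x) (z + r • x)
          have h2 := hconv w (w + r • x)
          have h3 := hsmooth z (z + r • x)
          rw [add_sub_add_right_eq_sub, ← neg_sub w z, inner_neg_right] at h1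
          rw [add_sub_cancel_left, real_inner_smul_right] at h2 h3
          rw [norm_smul, hx, mul_one, Real.norm_eq_abs, sq_abs] at h3
          have h4 : β / 2 * r ^ 2 ≤ β / 2 * γ ^ 2 := by gcongr
          rw [inner_sub_right, real_inner_comm (g w) x, real_inner_comm (g z) x]
          linarith
  obtain ⟨n, hn⟩ : ∃ n, Module.finrank ℝ E = n + 1 := ⟨_, (Nat.succ_pred_eq_of_pos hdim).symm⟩
  have hφ := hasDerivAt_integral_sphere_mul_inner hsph hdiff hconv w (w - z)
  have hparts := finrank_sub_one_mul_integral_sphere hsph hrot hdiff hconv w (w - z)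
  have hφ0 : ∫ x, f (w + (0 : ℝ) • x) * ⟪x, w - z⟫ ∂μ = 0 := by
    simp [integral_const_mul, integral_inner_eq_zero_of_rotation_invariant hrot]
  rw [hn] at hparts ⊢
  set φ : ℝ → ℝ := fun r => ∫ x, f (w + r • x) * ⟪x, w - z⟫ ∂μ
  have hψ : ∀ r, HasDerivAt (fun r => r ^ n * φ r - c * r ^ (n + 1) / ((n + 1 : ℕ) : ℝ))
      (n * r ^ (n - 1) * φ r + r ^ n * (∫ x, ⟪g (w + r • x), x⟫ * ⟪x, w - z⟫ ∂μ)
        - c * r ^ n) r := by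
    intro r
    have h := ((hasDerivAt_pow n r).mul (hφ r)).sub
      (((hasDerivAt_pow (n + 1) r).const_mul c).div_const ((n + 1 : ℕ) : ℝ))
    refine h.congr_deriv ?_
    have : ((n + 1 : ℕ) : ℝ) ≠ 0 := by positivity
    simp only [Nat.add_sub_cancel]
    field_simp
  have hmono : MonotoneOn (fun r => r ^ n * φ r - c * r ^ (n + 1) / ((n + 1 : ℕ) : ℝ))
      (Set.Icc 0 γ) := by
    refine monotoneOn_of_deriv_nonneg (convex_Icc 0 γ)
      (fun r _ => (hψ r).continuousAt.continuousWithinAt)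
      (fun r _ => (hψ r).differentiableAt.differentiableWithinAt) fun r hr => ?_
    rw [interior_Icc] at hr
    rw [(hψ r).deriv]
    refine nonneg_of_mul_nonneg_right ?_ hr.1
    have hp : r * (n * r ^ (n - 1)) = n * r ^ n := by
      rcases n with _ | m
      · simp
      · simp only [Nat.add_sub_cancel]; ring
    have hpr := hparts r
    push_cast at hpr
    have hfinal : r * (n * r ^ (n - 1) * φ r
        + r ^ n * (∫ x, ⟪g (w + r • x), x⟫ * ⟪x, w - z⟫ ∂μ) - c * r ^ n) =
        r ^ n * (r * ((∫ x, ⟪g (w + r • x), w - z⟫ ∂μ) - c)) := by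
      linear_combination φ r * hp + r ^ n * hpr
    rw [hfinal]
    have := hmean r hr.1.le hr.2.le
    exact mul_nonneg (pow_nonneg hr.1.le n) (mul_nonneg hr.1.le (sub_nonneg.2 this))
  have h := hmono (Set.left_mem_Icc.2 hγ.le) (Set.right_mem_Icc.2 hγ.le) hγ.le
  have hφ0' : φ 0 = 0 := hφ0
  simp only [hφ0', mul_zero, ne_eq, Nat.add_eq_zero_iff, one_ne_zero, and_false,
    not_false_eq_true, zero_pow, zero_div, sub_zero] at h
  have hγn : 0 < γ ^ n := pow_pos hγ n
  refine le_of_mul_le_mul_left ?_ hγn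
  calc γ ^ n * (c * γ / ((n + 1 : ℕ) : ℝ)) = c * γ ^ (n + 1) / ((n + 1 : ℕ) : ℝ) := by ring
    _ ≤ γ ^ n * φ γ := by linarith

end Sphere

/-- A nearest-point map onto a convex set does not increase the distance to points of the set. -/
theorem norm_nearest_sub_le {E : Type*} [NormedAddCommGroup E] [InnerProductSpace ℝ E]
    {K : Set E} (hK : Convex ℝ K) {p z y : E} (hp : p ∈ K) (hmin : ∀ y ∈ K, ‖p - z‖ ≤ ‖y - z‖)
    (hy : y ∈ K) : ‖p - y‖ ^ 2 ≤ ‖z - y‖ ^ 2 := by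
  have hinf : ‖z - p‖ = ⨅ w : K, ‖z - w‖ := by
    have : Nonempty K := ⟨⟨p, hp⟩⟩
    refine le_antisymm (le_ciInf fun w => ?_) (ciInf_le ⟨0, ?_⟩ (⟨p, hp⟩ : K))
    · rw [norm_sub_rev z p, norm_sub_rev z]
      exact hmin w w.2
    · rintro _ ⟨w, rfl⟩
      exact norm_nonneg _
  have h := (norm_eq_iInf_iff_real_inner_le_zero hK hp).1 hinf y hy
  have hsq : ‖z - y‖ ^ 2 = ‖z - p‖ ^ 2 - 2 * ⟪z - p, y - p⟫ + ‖y - p‖ ^ 2 := by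
    rw [← norm_sub_sq_real, sub_sub_sub_cancel_right]
  rw [norm_sub_rev p y]
  nlinarith [sq_nonneg ‖z - p‖]

/-- One-step progress for a linear transfer function `ρ(x) = c_ρ·x`:
if `f(w_t) − f(w*) > ε`, `γ = √(ε/(2β))`, `η = c_ρ·ε^{3/2}/(d·√(2β))`, `u` uniform on
the sphere and `o ∈ {±1}` with `E[o | u] = c_ρ·(f(w_t + γu) − f(w_t − γu))`, then
`E[‖Π_𝒟(w_t − η·o·u) − w*‖²] ≤ ‖w_t − w*‖² − c_ρ²·ε³/(2β·d²)`. -/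
theorem stmt13 (d : ℕ) (hd : 0 < d) (β cρ ε : ℝ)
    (hβ : 0 < β) (hcρ : 0 < cρ) (hε : 0 < ε)
    (𝒟 : Set (EuclideanSpace ℝ (Fin d))) (hconv : Convex ℝ 𝒟) (hclosed : IsClosed 𝒟)
    (hbdd : Bornology.IsBounded 𝒟)
    (f : EuclideanSpace ℝ (Fin d) → ℝ)
    (gradf : EuclideanSpace ℝ (Fin d) → EuclideanSpace ℝ (Fin d))
    (hdiff : ∀ x, HasGradientAt f (gradf x) x)
    (hconvf : ∀ x y, ⟪gradf x, y - x⟫ ≤ f y - f x)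
    (hsmooth : ∀ x y, f y ≤ f x + ⟪gradf x, y - x⟫ + β / 2 * ‖y - x‖ ^ 2)
    (wstar : EuclideanSpace ℝ (Fin d)) (hws : wstar ∈ 𝒟)
    (hmin : ∀ v ∈ 𝒟, f wstar ≤ f v)
    (γ η : ℝ) (hγdef : γ = Real.sqrt (ε / (2 * β)))
    (hηdef : η = cρ * ε ^ ((3 : ℝ) / 2) / (d * Real.sqrt (2 * β)))
    -- validity of the signed-Bernoulli feedback on a `γ`-neighbourhood of `𝒟`
    (hvalid : ∀ x y : EuclideanSpace ℝ (Fin d),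
      (∃ a ∈ 𝒟, ‖x - a‖ ≤ γ) → (∃ b ∈ 𝒟, ‖y - b‖ ≤ γ) → |cρ * (f x - f y)| ≤ 1)
    (proj : EuclideanSpace ℝ (Fin d) → EuclideanSpace ℝ (Fin d))
    (hprojmem : ∀ z, proj z ∈ 𝒟)
    (hproj : ∀ z, ∀ y ∈ 𝒟, ‖proj z - z‖ ≤ ‖y - z‖)
    (wt : EuclideanSpace ℝ (Fin d)) (hwt : wt ∈ 𝒟) (hgap : ε < f wt - f wstar)
    (μ : Measure (EuclideanSpace ℝ (Fin d))) [IsProbabilityMeasure μ]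
    (hsph : ∀ᵐ x ∂μ, ‖x‖ = 1)
    (hrot : ∀ T : EuclideanSpace ℝ (Fin d) ≃ₗᵢ[ℝ] EuclideanSpace ℝ (Fin d),
      Measure.map (⇑T) μ = μ)
    (Ω : Type) [MeasurableSpace Ω] (P : Measure Ω) [IsProbabilityMeasure P]
    (u : Ω → EuclideanSpace ℝ (Fin d)) (hu : Measurable u)
    (hulaw : Measure.map u P = μ)
    (o : Ω → ℝ) (ho : Measurable o) (hosign : ∀ ω, o ω = 1 ∨ o ω = -1)
    (hcond : P[o | MeasurableSpace.comap u inferInstance] =ᵐ[P]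
      fun ω => cρ * (f (wt + γ • u ω) - f (wt - γ • u ω))) :
    ∫ ω, ‖proj (wt - (η * o ω) • u ω) - wstar‖ ^ 2 ∂P ≤
      ‖wt - wstar‖ ^ 2 - cρ ^ 2 * ε ^ 3 / (2 * β * (d : ℝ) ^ 2) := by
  subst hulaw
  have hγ : 0 < γ := by rw [hγdef]; positivity
  have hγsq : γ ^ 2 = ε / (2 * β) := by rw [hγdef, Real.sq_sqrt (by positivity)]
  have hη : η = cρ * ε * γ / d := by
    have h32 : ε ^ ((3 : ℝ) / 2) = ε * Real.sqrt ε := by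
      rw [show (3 : ℝ) / 2 = 1 + 1 / 2 by norm_num, Real.rpow_add hε, Real.rpow_one,
        Real.sqrt_eq_rpow]
    rw [hηdef, hγdef, h32, Real.sqrt_div hε.le]
    field_simp
  have hη0 : 0 < η := by rw [hη]; positivity
  have hηsq : η ^ 2 = cρ ^ 2 * ε ^ 3 / (2 * β * (d : ℝ) ^ 2) := by
    rw [hη, div_pow, mul_pow, mul_pow, hγsq]
    field_simp
  have hfc : Continuous f := continuous_iff_continuousAt.2 fun x => (hdiff x).continuousAt
  have husph : ∀ᵐ ω ∂P, ‖u ω‖ = 1 := ae_of_ae_map hu.aemeasurable hsph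
  have hoabs : ∀ ω, |o ω| = 1 := fun ω => by rcases hosign ω with h | h <;> simp [h]
  have hIo : Integrable o P :=
    Integrable.of_bound ho.aestronglyMeasurable 1 (.of_forall fun ω => (hoabs ω).le)
  have hIov : Integrable (fun ω => o ω * ⟪u ω, wt - wstar⟫) P := by
    refine Integrable.of_bound (Measurable.aestronglyMeasurable (by fun_prop)) ‖wt - wstar‖ ?_
    filter_upwards [husph] with ω hω
    rw [norm_mul, Real.norm_eq_abs, hoabs, one_mul]
    simpa [hω] using abs_real_inner_le_norm (u ω) (wt - wstar)
  have hsphere := le_integral_sphere_mul_inner hsph hrot hdiff hconvf hβ.le hsmooth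
    (by simpa using hd) wt wstar (c := ε / 2) hγ (by
      have : β / 2 * γ ^ 2 = ε / 4 := by rw [hγsq]; field_simp; norm_num
      linarith)
  rw [finrank_euclideanSpace_fin] at hsphere
  have hbound : ∀ s : ℝ, Integrable
      (fun x => f (wt + s • x) * ⟪x, wt - wstar⟫) (Measure.map u P) := by
    intro s
    have hc : Continuous fun x => f (wt + s • x) * ⟪x, wt - wstar⟫ := by fun_prop
    obtain ⟨M, hM⟩ := (isCompact_sphere (0 : EuclideanSpace ℝ (Fin d))
      1).exists_bound_of_continuousOn hc.continuousOn
    exact integrable_of_bounded_on_sphere hsph hc.measurable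
      fun x hx => hM x (by simpa using hx)
  have hneg : ∫ x, f (wt + (-γ) • x) * ⟪x, wt - wstar⟫ ∂(Measure.map u P) =
      -∫ x, f (wt + γ • x) * ⟪x, wt - wstar⟫ ∂(Measure.map u P) := by
    conv_lhs => rw [← hrot (LinearIsometryEquiv.neg ℝ)]
    rw [integral_map (LinearIsometryEquiv.continuous _).aemeasurable
      (Continuous.aestronglyMeasurable (by fun_prop)), ← integral_neg]
    simp
  have hcorr : ∫ ω, o ω * ⟪u ω, wt - wstar⟫ ∂P =
      2 * cρ * ∫ x, f (wt + γ • x) * ⟪x, wt - wstar⟫ ∂(Measure.map u P) := by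
    have hpull := condExp_mul_of_aestronglyMeasurable_right (μ := P)
      (m := MeasurableSpace.comap u inferInstance) (f := o) (g := fun ω => ⟪u ω, wt - wstar⟫)
      (by
        have hi : Measurable fun x : EuclideanSpace ℝ (Fin d) => ⟪x, wt - wstar⟫ := by fun_prop
        exact (hi.comp (comap_measurable u)).stronglyMeasurable.aestronglyMeasurable) hIov hIo
    calc ∫ ω, o ω * ⟪u ω, wt - wstar⟫ ∂P
        = ∫ ω, cρ * (f (wt + γ • u ω) * ⟪u ω, wt - wstar⟫
            - f (wt + (-γ) • u ω) * ⟪u ω, wt - wstar⟫) ∂P := by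
          refine (integral_condExp hu.comap_le).symm.trans (integral_congr_ae ?_)
          filter_upwards [hpull, hcond] with ω h1 h2
          refine h1.trans ?_
          rw [Pi.mul_apply, h2, neg_smul, ← sub_eq_add_neg]
          ring
      _ = ∫ x, cρ * (f (wt + γ • x) * ⟪x, wt - wstar⟫
            - f (wt + (-γ) • x) * ⟪x, wt - wstar⟫) ∂(Measure.map u P) :=
          (integral_map hu.aemeasurable
            (((hbound γ).sub (hbound (-γ))).const_mul cρ).aestronglyMeasurable).symm
      _ = _ := by
          rw [integral_const_mul, integral_sub (hbound γ) (hbound (-γ)), hneg]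
          ring
  have hstep : ∀ᵐ ω ∂P, ‖proj (wt - (η * o ω) • u ω) - wstar‖ ^ 2 ≤
      ‖wt - wstar‖ ^ 2 + η ^ 2 - 2 * η * (o ω * ⟪u ω, wt - wstar⟫) := by
    filter_upwards [husph] with ω hω
    refine (norm_nearest_sub_le hconv (hprojmem _) (hproj _) hws).trans (le_of_eq ?_)
    rw [sub_right_comm, norm_sub_sq_real, real_inner_smul_right, norm_smul, hω, mul_one,
      Real.norm_eq_abs, abs_mul, hoabs, mul_one, sq_abs, real_inner_comm]
    ring
  calc ∫ ω, ‖proj (wt - (η * o ω) • u ω) - wstar‖ ^ 2 ∂P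
      ≤ ∫ ω, (‖wt - wstar‖ ^ 2 + η ^ 2 - 2 * η * (o ω * ⟪u ω, wt - wstar⟫)) ∂P :=
        integral_mono_of_nonneg (.of_forall fun ω => by positivity)
          ((integrable_const _).sub (hIov.const_mul _)) hstep
    _ = ‖wt - wstar‖ ^ 2 + η ^ 2 - 2 * η * ∫ ω, o ω * ⟪u ω, wt - wstar⟫ ∂P := by
        rw [integral_sub (integrable_const _) (hIov.const_mul _), integral_const_mul]
        simp
    _ ≤ ‖wt - wstar‖ ^ 2 + η ^ 2 - 2 * η * η := by
        gcongr
        rw [hcorr]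
        calc η = 2 * cρ * (ε / 2 * γ / d) := by rw [hη]; ring
          _ ≤ _ := by gcongr
    _ = ‖wt - wstar‖ ^ 2 - cρ ^ 2 * ε ^ 3 / (2 * β * (d : ℝ) ^ 2) := by rw [← hηsq]; ring
end

section
/- (Convergence rate with a linear transfer function.) Let 𝒟 ⊆ ℝ^d be convex, closed and bounded with ‖w_1 − w*‖ ≤ D, let f : 𝒟 → ℝ be convex and β-smooth with minimizer w* over 𝒟, and let the transfer function be linear: ρ(x) = c_ρ·x (assumed to take values in [−1, 1] on all realized function differences). Fix ε > 0, set γ = √(ε/(2β)), η = c_ρ·ε^{3/2}/(d·√(2β)), and T = 2d²·β·D²/(c_ρ²·ε³). Consider the process: w_1 ∈ 𝒟, and for t = 1, …, T: u_t uniform on S^{d−1} independent of the past, o_t ∈ {±1} with E[o_t | w_t, u_t] = c_ρ·(f(w_t + γu_t) − f(w_t − γu_t)), and w_{t+1} = Π_𝒟(w_t − η·o_t·u_t). Then min_{t ∈ [T]} E[f(w_t)] − f(w*) ≤ ε. -/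
open MeasureTheory ProbabilityTheory
open scoped RealInnerProductSpace

/-- The σ-algebra generated by the observations strictly before round `t`. -/
def dcoPast {Ω : Type} {d : ℕ} (u : ℕ → Ω → EuclideanSpace ℝ (Fin d))
    (o : ℕ → Ω → ℝ) (t : ℕ) : MeasurableSpace Ω :=
  ⨆ (s : ℕ) (_ : s < t),
    MeasurableSpace.comap (u s) inferInstance ⊔ MeasurableSpace.comap (o s) inferInstance


section SphereAveraging

variable {E : Type*} [NormedAddCommGroup E] [InnerProductSpace ℝ E]

/-- A convex function with a quadratic upper bound has a Lipschitz gradient. -/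
lemma norm_grad_sub_le_of_convex_of_smooth {f : E → ℝ} {g : E → E} {β : ℝ} (hβ : 0 < β)
    (hconv : ∀ x y, ⟪g x, y - x⟫ ≤ f y - f x)
    (hsmooth : ∀ x y, f y ≤ f x + ⟪g x, y - x⟫ + β / 2 * ‖y - x‖ ^ 2) (x y : E) :
    ‖g x - g y‖ ≤ β * ‖x - y‖ := by
  have key : ∀ x y, f x - f y + ⟪g x, y - x⟫ ≤ -(1 / (2 * β)) * ‖g y - g x‖ ^ 2 := by
    intro x y
    have h1 := hconv x (y - (1 / β) • (g y - g x))
    have h2 := hsmooth y (y - (1 / β) • (g y - g x))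
    have e1 : y - (1 / β) • (g y - g x) - x = (y - x) - (1 / β) • (g y - g x) := by abel
    have e2 : y - (1 / β) • (g y - g x) - y = -((1 / β) • (g y - g x)) := by abel
    have e3 : ⟪g y, g y - g x⟫ - ⟪g x, g y - g x⟫ = ‖g y - g x‖ ^ 2 := by
      rw [← inner_sub_left, real_inner_self_eq_norm_sq]
    rw [e1, inner_sub_right, inner_smul_right] at h1
    rw [e2, inner_neg_right, inner_smul_right, norm_neg, norm_smul, mul_pow, Real.norm_eq_abs,
      sq_abs] at h2
    have e4 : β / 2 * ((1 / β) ^ 2 * ‖g y - g x‖ ^ 2) = (1 / (2 * β)) * ‖g y - g x‖ ^ 2 := by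
      field_simp
    have e5 : 1 / β * ⟪g y, g y - g x⟫ - 1 / β * ⟪g x, g y - g x⟫
        = 2 * ((1 / (2 * β)) * ‖g y - g x‖ ^ 2) := by
      rw [← mul_sub, e3]; field_simp
    linarith
  have h1 := key x y
  have h2 := key y x
  rw [norm_sub_rev] at h1
  have e1 : ⟪g x, y - x⟫ + ⟪g y, x - y⟫ = -⟪g x - g y, x - y⟫ := by
    rw [← neg_sub x y, inner_neg_right, inner_sub_left]; ring
  have e2 := real_inner_le_norm (g x - g y) (x - y)
  have e3 : (1 / β) * ‖g x - g y‖ ^ 2 ≤ ‖g x - g y‖ * ‖x - y‖ := by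
    have : (1 / β) * ‖g x - g y‖ ^ 2 = 2 * ((1 / (2 * β)) * ‖g x - g y‖ ^ 2) := by field_simp
    linarith
  rcases (norm_nonneg (g x - g y)).eq_or_lt with h | h
  · rw [← h]; positivity
  · have : ‖g x - g y‖ * ‖g x - g y‖ ≤ ‖g x - g y‖ * (β * ‖x - y‖) := by
      have := mul_le_mul_of_nonneg_left e3 hβ.le
      have e : β * (1 / β * ‖g x - g y‖ ^ 2) = ‖g x - g y‖ * ‖g x - g y‖ := by field_simp
      linarith
    exact le_of_mul_le_mul_left this h

lemma continuous_grad_of_convex_of_smooth {f : E → ℝ} {g : E → E} {β : ℝ} (hβ : 0 < β)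
    (hconv : ∀ x y, ⟪g x, y - x⟫ ≤ f y - f x)
    (hsmooth : ∀ x y, f y ≤ f x + ⟪g x, y - x⟫ + β / 2 * ‖y - x‖ ^ 2) : Continuous g :=
  (LipschitzWith.of_dist_le' fun x y => by
    simpa only [dist_eq_norm] using
      norm_grad_sub_le_of_convex_of_smooth hβ hconv hsmooth x y).continuous

variable [MeasurableSpace E] [BorelSpace E] {μ : Measure E}

lemma integral_comp_linearIsometryEquiv_of_map_eq
    (hrot : ∀ R : E ≃ₗᵢ[ℝ] E, Measure.map R μ = μ) (R : E ≃ₗᵢ[ℝ] E) (h : E → ℝ) :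
    ∫ u, h (R u) ∂μ = ∫ u, h u ∂μ := by
  conv_rhs => rw [← hrot R]
  exact (R.toHomeomorph.measurableEmbedding.integral_map h).symm

lemma integral_comp_neg_of_map_eq (hrot : ∀ R : E ≃ₗᵢ[ℝ] E, Measure.map R μ = μ) (h : E → ℝ) :
    ∫ u, h (-u) ∂μ = ∫ u, h u ∂μ :=
  integral_comp_linearIsometryEquiv_of_map_eq hrot (LinearIsometryEquiv.neg ℝ) h

lemma integral_inner_eq_zero_of_map_eq (hrot : ∀ R : E ≃ₗᵢ[ℝ] E, Measure.map R μ = μ) (v : E) :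
    ∫ u, ⟪v, u⟫ ∂μ = 0 := by
  have := integral_comp_neg_of_map_eq hrot fun u => ⟪v, u⟫
  simp only [inner_neg_right, integral_neg] at this
  linarith

variable [FiniteDimensional ℝ E] [IsProbabilityMeasure μ]

lemma integrable_of_continuous_of_ae_norm_eq_one (hsph : ∀ᵐ x ∂μ, ‖x‖ = 1) {h : E → ℝ}
    (hh : Continuous h) : Integrable h μ := by
  have hres : μ.restrict (Metric.closedBall 0 1) = μ :=
    Measure.restrict_eq_self_of_ae_mem (hsph.mono fun x hx => by simp [hx])
  have := hh.continuousOn.integrableOn_compact (μ := μ) (isCompact_closedBall (0 : E) 1)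
  rwa [IntegrableOn, hres] at this

/-- Differentiation under the integral sign on the unit sphere. -/
lemma hasDerivAt_integral_of_ae_norm_eq_one (hsph : ∀ᵐ x ∂μ, ‖x‖ = 1) {k k' : ℝ → E → ℝ}
    {s : Set ℝ} (hs : IsOpen s) {θ₀ : ℝ} (hθ₀ : θ₀ ∈ s)
    (hkc : ∀ θ ∈ s, Continuous (k θ))
    (hk'c : ContinuousOn (Function.uncurry k') (s ×ˢ Set.univ))
    (hk : ∀ θ ∈ s, ∀ u, HasDerivAt (fun θ => k θ u) (k' θ u) θ) :
    HasDerivAt (fun θ => ∫ u, k θ u ∂μ) (∫ u, k' θ₀ u ∂μ) θ₀ := by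
  obtain ⟨δ, hδ, hball⟩ := Metric.nhds_basis_closedBall.mem_iff.1 (hs.mem_nhds hθ₀)
  obtain ⟨C, hC⟩ := ((isCompact_closedBall θ₀ δ).prod (isCompact_closedBall (0 : E) 1)
    ).exists_bound_of_continuousOn (hk'c.mono (Set.prod_mono hball (Set.subset_univ _)))
  refine (hasDerivAt_integral_of_dominated_loc_of_deriv_le (bound := fun _ => C)
    (Metric.closedBall_mem_nhds θ₀ hδ) ?_ ?_ ?_ ?_ (integrable_const C) ?_).2
  · filter_upwards [hs.mem_nhds hθ₀] with θ hθ
    exact (hkc θ hθ).aestronglyMeasurable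
  · exact integrable_of_continuous_of_ae_norm_eq_one hsph (hkc θ₀ hθ₀)
  · refine Continuous.aestronglyMeasurable ?_
    exact hk'c.comp_continuous (f := fun u => (θ₀, u)) (by fun_prop) (fun u => ⟨hθ₀, trivial⟩)
  · filter_upwards [hsph] with u hu θ hθ
    exact hC (θ, u) ⟨hθ, by simp [hu]⟩
  · exact Filter.Eventually.of_forall fun u θ hθ => hk θ (hball hθ) u


/-- The infinitesimal form of rotation invariance: the derivative of a function along the
rotation field of the plane spanned by `a` and `b` has mean zero. -/
lemma integral_inner_grad_rotation_eq_zero (hsph : ∀ᵐ x ∂μ, ‖x‖ = 1)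
    (hrot : ∀ R : E ≃ₗᵢ[ℝ] E, Measure.map R μ = μ) {h : E → ℝ} {g : E → E}
    (hg : Continuous g) (hh : ∀ x, HasGradientAt h (g x) x) {a : E} (ha : ‖a‖ = 1) (b : E) :
    ∫ u, ⟪g u, ⟪a, u⟫ • b - ⟪b, u⟫ • a⟫ ∂μ = 0 := by
  have hhc : Continuous h := continuous_iff_continuousAt.2 fun x =>
    (hh x).hasFDerivAt.continuousAt
  let v : ℝ → E := fun θ => a + θ • b
  let R : ℝ → E ≃ₗᵢ[ℝ] E := fun θ => (ℝ ∙ v θ).reflection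
  let S : ℝ → E → E := fun θ u => (2 * (⟪v θ, u⟫ / ‖v θ‖ ^ 2)) • v θ - u
  let S' : ℝ → E → E := fun θ u =>
    (2 * (⟪v θ, u⟫ / ‖v θ‖ ^ 2)) • b
      + (2 * ((⟪b, u⟫ * ‖v θ‖ ^ 2 - ⟪v θ, u⟫ * (2 * ⟪v θ, b⟫)) / (‖v θ‖ ^ 2) ^ 2)) • v θ
  have hRS : ∀ θ u, R θ u = S θ u := by
    intro θ u
    simp only [R, S, Submodule.reflection_singleton_apply, mul_smul, two_smul]
    simp
  have hvc : Continuous v := by fun_prop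
  have hv0 : v 0 = a := by simp [v]
  let s : Set ℝ := {θ | v θ ≠ 0}
  have hs : IsOpen s := isOpen_ne_fun hvc continuous_const
  have h0 : (0 : ℝ) ∈ s := by
    change v 0 ≠ 0
    rw [hv0]; intro h; simp [h] at ha
  have hvd : ∀ θ, HasDerivAt v b θ := by
    intro θ
    simpa [v] using ((hasDerivAt_id θ).smul_const b).const_add a
  have hSd : ∀ θ ∈ s, ∀ u, HasDerivAt (fun θ => S θ u) (S' θ u) θ := by
    intro θ hθ u
    have hn : ‖v θ‖ ^ 2 ≠ 0 := pow_ne_zero _ (norm_ne_zero_iff.2 hθ)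
    have d1 : HasDerivAt (fun θ => ⟪v θ, u⟫) ⟪b, u⟫ θ := by
      simpa using (hvd θ).inner ℝ (hasDerivAt_const θ u)
    have d2 : HasDerivAt (fun θ => ‖v θ‖ ^ 2) (2 * ⟪v θ, b⟫) θ := (hvd θ).norm_sq
    have d3 := (((d1.div d2 hn).const_mul 2).smul (hvd θ)).sub_const u
    exact d3
  have hkd : ∀ θ ∈ s, ∀ u, HasDerivAt (fun θ => h (S θ u)) ⟪g (S θ u), S' θ u⟫ θ := by
    intro θ hθ u
    have := (hh (S θ u)).hasFDerivAt.comp_hasDerivAt θ (hSd θ hθ u)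
    rw [InnerProductSpace.toDual_apply_apply] at this
    exact this
  have hc : ContinuousOn (Function.uncurry fun θ u => ⟪g (S θ u), S' θ u⟫)
      (s ×ˢ Set.univ) := by
    have hn : ∀ p ∈ s ×ˢ (Set.univ : Set E), ‖v p.1‖ ^ 2 ≠ 0 := fun p hp =>
      pow_ne_zero _ (norm_ne_zero_iff.2 hp.1)
    have hn2 : ∀ p ∈ s ×ˢ (Set.univ : Set E), (‖v p.1‖ ^ 2) ^ 2 ≠ 0 := fun p hp =>
      pow_ne_zero _ (hn p hp)
    have hq : ContinuousOn (fun p : ℝ × E => ⟪v p.1, p.2⟫ / ‖v p.1‖ ^ 2) (s ×ˢ Set.univ) :=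
      ContinuousOn.div (by fun_prop) (by fun_prop) hn
    have hq' : ContinuousOn (fun p : ℝ × E => (⟪b, p.2⟫ * ‖v p.1‖ ^ 2
        - ⟪v p.1, p.2⟫ * (2 * ⟪v p.1, b⟫)) / (‖v p.1‖ ^ 2) ^ 2) (s ×ˢ Set.univ) :=
      ContinuousOn.div (by fun_prop) (by fun_prop) hn2
    have hS : ContinuousOn (fun p : ℝ × E => S p.1 p.2) (s ×ˢ Set.univ) := by
      simp only [S]; fun_prop
    have hS' : ContinuousOn (fun p : ℝ × E => S' p.1 p.2) (s ×ˢ Set.univ) := by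
      simp only [S']; fun_prop
    exact (hg.comp_continuousOn hS).inner hS'
  have hder := hasDerivAt_integral_of_ae_norm_eq_one hsph (k := fun θ u => h (S θ u)) hs h0
    (fun θ _ => by simp only [S]; fun_prop) hc hkd
  have hconst : (fun θ => ∫ u, h (S θ u) ∂μ) = fun _ => ∫ u, h u ∂μ := by
    funext θ
    simp only [← hRS]
    exact integral_comp_linearIsometryEquiv_of_map_eq hrot (R θ) h
  rw [hconst] at hder
  have hzero := hder.unique (hasDerivAt_const _ _)
  rw [← integral_comp_linearIsometryEquiv_of_map_eq hrot (R 0)] at hzero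
  have haa : ⟪a, a⟫ = 1 := by simp [ha]
  have hpt : ∀ u, ⟪g (S 0 (R 0 u)), S' 0 (R 0 u)⟫
      = 2 * ⟪g u, ⟪a, u⟫ • b - ⟪b, u⟫ • a⟫ := by
    intro u
    have e1 : S 0 (R 0 u) = u := by
      rw [← hRS]; exact Submodule.reflection_reflection _ _
    have e2 : R 0 u = (2 * ⟪a, u⟫) • a - u := by
      rw [hRS]; simp [S, hv0, ha]
    rw [e1, e2]
    simp only [S', hv0, ha, inner_sub_right, inner_add_right, inner_smul_right, haa,
      real_inner_comm b a]
    ring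
  simp only [hpt, integral_const_mul] at hzero
  linarith

/-- Integration by parts on the unit sphere. -/
lemma sphere_integral_mul_inner (hsph : ∀ᵐ x ∂μ, ‖x‖ = 1)
    (hrot : ∀ R : E ≃ₗᵢ[ℝ] E, Measure.map R μ = μ) {h : E → ℝ} {g : E → E}
    (hg : Continuous g) (hh : ∀ x, HasGradientAt h (g x) x) (x : E) :
    ((Module.finrank ℝ E : ℝ) - 1) * ∫ u, h u * ⟪x, u⟫ ∂μ
      = ∫ u, ⟪g u, x⟫ ∂μ - ∫ u, ⟪g u, u⟫ * ⟪x, u⟫ ∂μ := by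
  have hhc : Continuous h := continuous_iff_continuousAt.2 fun x =>
    (hh x).hasFDerivAt.continuousAt
  let e := stdOrthonormalBasis ℝ E
  have hgrad : ∀ i x, HasGradientAt (fun u => h u * ⟪e i, u⟫)
      (⟪e i, x⟫ • g x + h x • e i) x := by
    intro i x
    have d1 : HasFDerivAt (fun u => ⟪e i, u⟫) (InnerProductSpace.toDual ℝ E (e i)) x :=
      (InnerProductSpace.toDual ℝ E (e i)).hasFDerivAt
    have := (hh x).hasFDerivAt.mul d1
    rw [hasGradientAt_iff_hasFDerivAt]
    refine this.congr_fderiv ?_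
    rw [map_add, map_smul, map_smul, add_comm]
  have hz : ∀ i, ∫ u, ⟪⟪e i, u⟫ • g u + h u • e i, ⟪e i, u⟫ • x - ⟪x, u⟫ • e i⟫ ∂μ = 0 :=
    fun i => integral_inner_grad_rotation_eq_zero hsph hrot (by fun_prop) (hgrad i)
      (e.orthonormal.1 i) x
  have hsum := Finset.sum_eq_zero fun i (_ : i ∈ Finset.univ) => hz i
  rw [← integral_finsetSum _ fun i _ =>
    integrable_of_continuous_of_ae_norm_eq_one hsph (by fun_prop)] at hsum
  have hae : (fun u => ∑ i, ⟪⟪e i, u⟫ • g u + h u • e i, ⟪e i, u⟫ • x - ⟪x, u⟫ • e i⟫)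
      =ᵐ[μ] fun u => (⟪g u, x⟫ - ⟪g u, u⟫ * ⟪x, u⟫)
        - ((Module.finrank ℝ E : ℝ) - 1) * (h u * ⟪x, u⟫) := by
    filter_upwards [hsph] with u hu
    have s1 : ∑ i, ⟪u, e i⟫ * ⟪e i, u⟫ = 1 := by
      rw [e.sum_inner_mul_inner, real_inner_self_eq_norm_sq, hu]; norm_num
    have s2 := e.sum_inner_mul_inner (g u) u
    have s3 := e.sum_inner_mul_inner x u
    have hi : ∀ i, ⟪⟪e i, u⟫ • g u + h u • e i, ⟪e i, u⟫ • x - ⟪x, u⟫ • e i⟫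
        = ⟪g u, x⟫ * (⟪u, e i⟫ * ⟪e i, u⟫) - ⟪x, u⟫ * (⟪g u, e i⟫ * ⟪e i, u⟫)
          + h u * (⟪x, e i⟫ * ⟪e i, u⟫) - h u * ⟪x, u⟫ := by
      intro i
      have hee : ⟪e i, e i⟫ = 1 := by simp
      simp only [inner_add_left, inner_sub_right, inner_smul_left, inner_smul_right, hee,
        real_inner_comm u (e i), real_inner_comm x (e i), conj_trivial]
      ring
    simp only [hi, Finset.sum_add_distrib, Finset.sum_sub_distrib, ← Finset.mul_sum, s1, s2, s3]
    simp
    ring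
  rw [integral_congr_ae hae, integral_sub, integral_sub, integral_const_mul] at hsum
  · linarith
  all_goals exact integrable_of_continuous_of_ae_norm_eq_one hsph (by fun_prop)

/-- The mean of the one-point gradient estimate, paired with `w - z`, dominates the gap
`f w - f z` up to the smoothing error. -/
lemma sphere_integral_mul_inner_ge [Nontrivial E] (hsph : ∀ᵐ x ∂μ, ‖x‖ = 1)
    (hrot : ∀ R : E ≃ₗᵢ[ℝ] E, Measure.map R μ = μ) {f : E → ℝ} {g : E → E} {β : ℝ}
    (hβ : 0 < β) (hf : ∀ x, HasGradientAt f (g x) x)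
    (hconv : ∀ x y, ⟪g x, y - x⟫ ≤ f y - f x)
    (hsmooth : ∀ x y, f y ≤ f x + ⟪g x, y - x⟫ + β / 2 * ‖y - x‖ ^ 2)
    {γ : ℝ} (hγ : 0 < γ) (w z : E) :
    γ / Module.finrank ℝ E * (f w - f z - β / 2 * γ ^ 2)
      ≤ ∫ u, f (w + γ • u) * ⟪w - z, u⟫ ∂μ := by
  have hg : Continuous g := continuous_grad_of_convex_of_smooth hβ hconv hsmooth
  have hfc : Continuous f := continuous_iff_continuousAt.2 fun x =>
    (hf x).hasFDerivAt.continuousAt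
  obtain ⟨m, hm⟩ : ∃ m, Module.finrank ℝ E = m + 1 :=
    ⟨_, (Nat.succ_pred_eq_of_pos Module.finrank_pos).symm⟩
  set K := f w - f z - β / 2 * γ ^ 2 with hK
  let φ : ℝ → ℝ := fun r => ∫ u, f (w + r • u) * ⟪w - z, u⟫ ∂μ
  let φ' : ℝ → ℝ := fun r => ∫ u, ⟪g (w + r • u), u⟫ * ⟪w - z, u⟫ ∂μ
  let H : ℝ → ℝ := fun r => ∫ u, ⟪g (w + r • u), w - z⟫ ∂μ
  have hφ : ∀ r, HasDerivAt φ (φ' r) r := by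
    intro r
    refine hasDerivAt_integral_of_ae_norm_eq_one hsph (s := Set.univ)
      (k := fun r u => f (w + r • u) * ⟪w - z, u⟫)
      (k' := fun r u => ⟪g (w + r • u), u⟫ * ⟪w - z, u⟫) isOpen_univ trivial
      (fun θ _ => by fun_prop) (Continuous.continuousOn ?_) ?_
    · simp only [Function.uncurry_def]; fun_prop
    · intro θ _ u
      have d1 : HasDerivAt (fun θ : ℝ => w + θ • u) u θ := by
        simpa using ((hasDerivAt_id θ).smul_const u).const_add w
      have d2 := (hf (w + θ • u)).hasFDerivAt.comp_hasDerivAt θ d1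
      simp only [InnerProductSpace.toDual_apply_apply] at d2
      exact d2.mul_const _
  have hparts : ∀ r, (m : ℝ) * φ r + r * φ' r = r * H r := by
    intro r
    have hgr : ∀ x, HasGradientAt (fun u => f (w + r • u)) (r • g (w + r • x)) x := by
      intro x
      have d1 : HasFDerivAt (fun u : E => w + r • u) (r • ContinuousLinearMap.id ℝ E) x :=
        ((hasFDerivAt_id x).const_smul r).const_add w
      have d2 := (hf (w + r • x)).hasFDerivAt.comp x d1
      rw [hasGradientAt_iff_hasFDerivAt]
      refine d2.congr_fderiv ?_
      ext y
      simp
    have := sphere_integral_mul_inner hsph hrot (by fun_prop) hgr (w - z)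
    simp only [inner_smul_left, conj_trivial, mul_assoc, integral_const_mul, hm] at this
    push_cast at this
    simp only [φ, φ', H]
    linarith
  have hH : ∀ r ∈ Set.Ioo 0 γ, K ≤ H r := by
    rintro r ⟨hr0, hrγ⟩
    have hint : ∫ u, (f w - f z - β / 2 * r ^ 2 + ⟪r • (g w - g z), u⟫) ∂μ
        = f w - f z - β / 2 * r ^ 2 := by
      rw [integral_add (integrable_const _)
        (integrable_of_continuous_of_ae_norm_eq_one hsph (by fun_prop)),
        integral_inner_eq_zero_of_map_eq hrot]
      simp
    have hle : f w - f z - β / 2 * r ^ 2 ≤ H r := by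
      rw [← hint]
      refine integral_mono_ae (integrable_of_continuous_of_ae_norm_eq_one hsph (by fun_prop))
        (integrable_of_continuous_of_ae_norm_eq_one hsph (by fun_prop)) ?_
      filter_upwards [hsph] with u hu
      have c1 := hconv (w + r • u) (z + r • u)
      have c2 := hconv w (w + r • u)
      have c3 := hsmooth z (z + r • u)
      rw [show z + r • u - (w + r • u) = -(w - z) by abel, inner_neg_right] at c1
      rw [add_sub_cancel_left, inner_smul_right] at c2 c3
      rw [norm_smul, hu, mul_one, Real.norm_eq_abs, sq_abs] at c3
      rw [inner_smul_left, inner_sub_left, conj_trivial]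
      linarith
    have : β / 2 * r ^ 2 ≤ β / 2 * γ ^ 2 := by gcongr
    linarith
  have hmono : MonotoneOn (fun r => r ^ m * φ r - r ^ (m + 1) / (m + 1 : ℝ) * K)
      (Set.Icc 0 γ) := by
    have hd : ∀ r, HasDerivAt (fun r => r ^ m * φ r - r ^ (m + 1) / (m + 1 : ℝ) * K)
        ((m * r ^ (m - 1)) * φ r + r ^ m * φ' r - r ^ m * K) r := by
      intro r
      have d1 := (hasDerivAt_pow m r).mul (hφ r)
      have d2 := ((hasDerivAt_pow (m + 1) r).div_const (m + 1 : ℝ)).mul_const K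
      refine (d1.sub d2).congr_deriv ?_
      have : (m : ℝ) + 1 ≠ 0 := by positivity
      rw [Nat.cast_add_one, Nat.add_sub_cancel, mul_div_cancel_left₀ _ this]
    refine monotoneOn_of_deriv_nonneg (convex_Icc _ _)
      (fun r _ => (hd r).continuousAt.continuousWithinAt)
      (fun r _ => (hd r).differentiableAt.differentiableWithinAt) ?_
    intro r hr
    rw [interior_Icc] at hr
    rw [(hd r).deriv]
    have hr0 : r ≠ 0 := hr.1.ne'
    have e1 : (m : ℝ) * r ^ (m - 1) * φ r + r ^ m * φ' r = r ^ m * H r := by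
      have h1 := hparts r
      rcases m with _ | n
      · simp only [Nat.cast_zero, zero_mul, zero_add] at h1
        simpa using mul_left_cancel₀ hr0 h1
      · rw [Nat.add_sub_cancel, pow_succ]
        linear_combination r ^ n * h1
    rw [e1, ← mul_sub]
    exact mul_nonneg (pow_nonneg hr.1.le _) (sub_nonneg.2 (hH r hr))
  have h0 : φ 0 = 0 := by
    simp [φ, integral_const_mul, integral_inner_eq_zero_of_map_eq hrot]
  have hfin := hmono ⟨le_rfl, hγ.le⟩ ⟨hγ.le, le_rfl⟩ hγ.le
  simp only [h0, mul_zero, zero_pow (Nat.succ_ne_zero m), zero_div, zero_mul, sub_zero] at hfin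
  have hfin' : 0 ≤ γ ^ m * (φ γ - γ / (m + 1 : ℝ) * K) := by
    calc (0 : ℝ) ≤ _ := hfin
      _ = _ := by rw [pow_succ]; ring
  have := nonneg_of_mul_nonneg_right hfin' (pow_pos hγ m)
  rw [hm]
  push_cast
  simp only [φ] at this
  linarith

/-- The mean of the two-point gradient estimate, paired with `w - z`, dominates the gap
`f w - f z` up to the smoothing error. -/
lemma sphere_integral_two_point_ge [Nontrivial E] (hsph : ∀ᵐ x ∂μ, ‖x‖ = 1)
    (hrot : ∀ R : E ≃ₗᵢ[ℝ] E, Measure.map R μ = μ) {f : E → ℝ} {g : E → E} {β : ℝ}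
    (hβ : 0 < β) (hf : ∀ x, HasGradientAt f (g x) x)
    (hconv : ∀ x y, ⟪g x, y - x⟫ ≤ f y - f x)
    (hsmooth : ∀ x y, f y ≤ f x + ⟪g x, y - x⟫ + β / 2 * ‖y - x‖ ^ 2)
    {γ : ℝ} (hγ : 0 < γ) (w z : E) :
    2 * γ / Module.finrank ℝ E * (f w - f z - β / 2 * γ ^ 2)
      ≤ ∫ u, (f (w + γ • u) - f (w - γ • u)) * ⟪w - z, u⟫ ∂μ := by
  have hfc : Continuous f := continuous_iff_continuousAt.2 fun x =>
    (hf x).hasFDerivAt.continuousAt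
  have h1 := sphere_integral_mul_inner_ge hsph hrot hβ hf hconv hsmooth hγ w z
  have h2 := integral_comp_neg_of_map_eq hrot fun u => f (w + γ • u) * ⟪w - z, u⟫
  simp only [smul_neg, inner_neg_right, mul_neg, integral_neg, ← sub_eq_add_neg] at h2
  simp only [sub_mul]
  rw [integral_sub, ← h2]
  · rw [← h2] at h1
    calc _ = 2 * (γ / Module.finrank ℝ E * (f w - f z - β / 2 * γ ^ 2)) := by ring
      _ ≤ _ := by simp only [sub_eq_add_neg] at h1 ⊢; linarith
  all_goals exact integrable_of_continuous_of_ae_norm_eq_one hsph (by fun_prop)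

end SphereAveraging

section Projection

variable {E : Type*} [NormedAddCommGroup E] [InnerProductSpace ℝ E]

/-- A nearest-point map onto a convex set is nonexpansive. -/
lemma norm_nearestPoint_sub_le {K : Set E} (hK : Convex ℝ K) {p : E → E}
    (hmem : ∀ z, p z ∈ K) (hmin : ∀ z, ∀ y ∈ K, ‖p z - z‖ ≤ ‖y - z‖) (x y : E) :
    ‖p x - p y‖ ≤ ‖x - y‖ := by
  have hvar : ∀ z, ∀ v ∈ K, ⟪z - p z, v - p z⟫ ≤ 0 := by
    intro z
    refine (norm_eq_iInf_iff_real_inner_le_zero hK (hmem z)).1 ?_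
    have : Nonempty K := ⟨⟨p z, hmem z⟩⟩
    refine le_antisymm (le_ciInf fun v => ?_) ?_
    · rw [norm_sub_rev z, norm_sub_rev z]; exact hmin z v v.2
    · exact ciInf_le (f := fun v : K => ‖z - v‖)
        ⟨0, Set.forall_mem_range.2 fun v => norm_nonneg _⟩ ⟨p z, hmem z⟩
  have h1 := hvar x (p y) (hmem y)
  have h2 := hvar y (p x) (hmem x)
  have h3 : ⟪x - p x, p y - p x⟫ + ⟪y - p y, p x - p y⟫
      = ‖p x - p y‖ ^ 2 - ⟪x - y, p x - p y⟫ := by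
    rw [← neg_sub (p x) (p y), inner_neg_right, neg_add_eq_sub, ← inner_sub_left,
      ← real_inner_self_eq_norm_sq, ← inner_sub_left]
    congr 1
    abel
  have h4 := real_inner_le_norm (x - y) (p x - p y)
  rcases (norm_nonneg (p x - p y)).eq_or_lt with h | h
  · rw [← h]; positivity
  · nlinarith

lemma continuous_nearestPoint {K : Set E} (hK : Convex ℝ K) {p : E → E}
    (hmem : ∀ z, p z ∈ K) (hmin : ∀ z, ∀ y ∈ K, ‖p z - z‖ ≤ ‖y - z‖) : Continuous p :=
  (LipschitzWith.of_dist_le_mul (K := 1) fun x y => by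
    simpa [dist_eq_norm] using norm_nearestPoint_sub_le hK hmem hmin x y).continuous

/-- One projected step decreases the squared distance to a point of the set as expected. -/
lemma norm_nearestPoint_step_sq_le {K : Set E} (hK : Convex ℝ K) {p : E → E}
    (hmem : ∀ z, p z ∈ K) (hmin : ∀ z, ∀ y ∈ K, ‖p z - z‖ ≤ ‖y - z‖) {z : E} (hz : z ∈ K)
    (w v : E) (η : ℝ) :
    ‖p (w - η • v) - z‖ ^ 2 ≤ ‖w - z‖ ^ 2 - 2 * η * ⟪w - z, v⟫ + η ^ 2 * ‖v‖ ^ 2 := by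
  have hpz : p z = z := by
    have := hmin z z hz
    rw [sub_self, norm_zero] at this
    exact sub_eq_zero.1 (norm_le_zero_iff.1 this)
  have h := norm_nearestPoint_sub_le hK hmem hmin (w - η • v) z
  rw [hpz] at h
  calc ‖p (w - η • v) - z‖ ^ 2 ≤ ‖w - η • v - z‖ ^ 2 := by gcongr
    _ = ‖(w - z) - η • v‖ ^ 2 := by rw [sub_right_comm]
    _ = _ := by
      rw [norm_sub_sq_real, inner_smul_right, norm_smul, mul_pow, Real.norm_eq_abs, sq_abs]
      ring

end Projection

lemma integrable_continuous_comp_of_ae_norm_le {Ω F : Type*} [MeasurableSpace Ω] {P : Measure Ω}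
    [IsFiniteMeasure P] [NormedAddCommGroup F] [ProperSpace F] [MeasurableSpace F] [BorelSpace F]
    {X : Ω → F} (hX : Measurable X) {C : ℝ} (hC : ∀ᵐ ω ∂P, ‖X ω‖ ≤ C) {h : F → ℝ}
    (hh : Continuous h) : Integrable (fun ω => h (X ω)) P := by
  obtain ⟨B, hB⟩ := (isCompact_closedBall (0 : F) C).exists_bound_of_continuousOn hh.continuousOn
  refine Integrable.of_bound (hh.measurable.comp hX).aestronglyMeasurable B ?_
  filter_upwards [hC] with ω hω
  exact hB _ (by simpa using hω)

/-- The correlation of the feedback sign with the direction, given by the two-point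
estimate at a point `W` determined by the past. -/
lemma integral_feedback_mul_inner_ge {E : Type*} [NormedAddCommGroup E] [InnerProductSpace ℝ E]
    [FiniteDimensional ℝ E] [Nontrivial E] [MeasurableSpace E] [BorelSpace E] {μ : Measure E}
    [IsProbabilityMeasure μ] (hsph : ∀ᵐ x ∂μ, ‖x‖ = 1)
    (hrot : ∀ R : E ≃ₗᵢ[ℝ] E, Measure.map R μ = μ) {f : E → ℝ} {g : E → E} {β : ℝ}
    (hβ : 0 < β) (hf : ∀ x, HasGradientAt f (g x) x)
    (hconv : ∀ x y, ⟪g x, y - x⟫ ≤ f y - f x)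
    (hsmooth : ∀ x y, f y ≤ f x + ⟪g x, y - x⟫ + β / 2 * ‖y - x‖ ^ 2)
    {γ c : ℝ} (hγ : 0 < γ) (hc : 0 < c) (z : E)
    {Ω : Type*} {m mΩ : MeasurableSpace Ω} {P : Measure Ω} [IsProbabilityMeasure P]
    (hm : m ≤ mΩ) {U W : Ω → E} {O : Ω → ℝ} (hU : Measurable U) (hlaw : Measure.map U P = μ)
    (hind : Indep (MeasurableSpace.comap U inferInstance) m P) (hW : Measurable[m] W)
    {C : ℝ} (hWC : ∀ ω, ‖W ω‖ ≤ C) (hO : Integrable O P)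
    (hcond : P[O | m ⊔ MeasurableSpace.comap U inferInstance]
      =ᵐ[P] fun ω => c * (f (W ω + γ • U ω) - f (W ω - γ • U ω))) :
    c * (2 * γ / Module.finrank ℝ E * ((∫ ω, f (W ω) ∂P) - f z - β / 2 * γ ^ 2))
      ≤ ∫ ω, O ω * ⟪W ω - z, U ω⟫ ∂P := by
  have hfc : Continuous f := continuous_iff_continuousAt.2 fun x =>
    (hf x).hasFDerivAt.continuousAt
  have hWΩ : Measurable W := hW.mono hm le_rfl
  have hUone : ∀ᵐ ω ∂P, ‖U ω‖ = 1 := ae_of_ae_map hU.aemeasurable (by rwa [hlaw])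
  have hm' : m ⊔ MeasurableSpace.comap U inferInstance ≤ mΩ := sup_le hm hU.comap_le
  have hpair : ∀ᵐ ω ∂P, ‖(W ω, U ω)‖ ≤ max C 1 := by
    filter_upwards [hUone] with ω hω
    exact max_le_max (hWC ω) hω.le
  let F : E × E → ℝ := fun p => (f (p.1 + γ • p.2) - f (p.1 - γ • p.2)) * ⟪p.1 - z, p.2⟫
  have hF : Continuous F := by fun_prop
  have hFint : Integrable (fun ω => F (W ω, U ω)) P :=
    integrable_continuous_comp_of_ae_norm_le (hWΩ.prodMk hU) hpair hF
  have hZ : StronglyMeasurable[m ⊔ MeasurableSpace.comap U inferInstance]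
      fun ω => ⟪W ω - z, U ω⟫ := by
    have h1 : Measurable[m ⊔ MeasurableSpace.comap U inferInstance] W := hW.mono le_sup_left le_rfl
    have h2 : Measurable[m ⊔ MeasurableSpace.comap U inferInstance] U :=
      (comap_measurable U).mono le_sup_right le_rfl
    exact (Measurable.inner (h1.sub_const z) h2).stronglyMeasurable
  have hZb : ∀ᵐ ω ∂P, ‖⟪W ω - z, U ω⟫‖ ≤ C + ‖z‖ := by
    filter_upwards [hUone] with ω hω
    calc ‖⟪W ω - z, U ω⟫‖ ≤ ‖W ω - z‖ * ‖U ω‖ := norm_inner_le_norm _ _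
      _ ≤ C + ‖z‖ := by rw [hω, mul_one]; exact (norm_sub_le _ _).trans (by gcongr; exact hWC ω)
  have hpull := condExp_stronglyMeasurable_mul_of_bound hm' hZ hO _ hZb
  have hOF : ∫ ω, O ω * ⟪W ω - z, U ω⟫ ∂P = c * ∫ ω, F (W ω, U ω) ∂P := by
    rw [← integral_const_mul]
    calc ∫ ω, O ω * ⟪W ω - z, U ω⟫ ∂P = ∫ ω, ((fun ω => ⟪W ω - z, U ω⟫) * O) ω ∂P := by
          simp only [Pi.mul_apply, mul_comm]
      _ = ∫ ω, (P[(fun ω => ⟪W ω - z, U ω⟫) * O | m ⊔ MeasurableSpace.comap U inferInstance]) ω ∂P :=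
          (integral_condExp hm').symm
      _ = _ := by
          refine integral_congr_ae ?_
          filter_upwards [hpull, hcond] with ω h1 h2
          rw [h1, Pi.mul_apply, h2]
          simp only [F]
          ring
  have hindWU : IndepFun W U P :=
    ((IndepFun_iff_Indep U W P).2 (indep_of_indep_of_le_right hind hW.comap_le)).symm
  have hmap : Measure.map (fun ω => (W ω, U ω)) P = (Measure.map W P).prod μ := by
    rw [(indepFun_iff_map_prod_eq_prod_map_map hWΩ.aemeasurable hU.aemeasurable).1 hindWU, hlaw]
  have hprob : IsProbabilityMeasure (Measure.map W P) :=
    Measure.isProbabilityMeasure_map hWΩ.aemeasurable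
  have hFprod : Integrable F ((Measure.map W P).prod μ) := by
    rw [← hmap]
    exact (integrable_map_measure hF.aestronglyMeasurable (hWΩ.prodMk hU).aemeasurable).2 hFint
  have hfubini : ∫ ω, F (W ω, U ω) ∂P = ∫ ω, ∫ v, F (W ω, v) ∂μ ∂P := by
    rw [← integral_map (f := F) (hWΩ.prodMk hU).aemeasurable hF.aestronglyMeasurable, hmap,
      integral_prod _ hFprod,
      integral_map hWΩ.aemeasurable hFprod.integral_prod_left.aestronglyMeasurable]
  have hfW : Integrable (fun ω => f (W ω)) P :=
    integrable_continuous_comp_of_ae_norm_le hWΩ (.of_forall hWC) hfc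
  have hgap : Integrable (fun ω => f (W ω) - f z) P := hfW.sub (integrable_const _)
  rw [hOF, hfubini]
  refine mul_le_mul_of_nonneg_left ?_ hc.le
  calc 2 * γ / Module.finrank ℝ E * ((∫ ω, f (W ω) ∂P) - f z - β / 2 * γ ^ 2)
      = ∫ ω, 2 * γ / Module.finrank ℝ E * (f (W ω) - f z - β / 2 * γ ^ 2) ∂P := by
        rw [integral_const_mul, integral_sub hgap (integrable_const _),
          integral_sub hfW (integrable_const _)]
        simp
    _ ≤ _ := by
        refine integral_mono ((hgap.sub (integrable_const _)).const_mul _) ?_ fun ω =>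
            sphere_integral_two_point_ge hsph hrot hβ hf hconv hsmooth hγ (W ω) z
        exact (integrable_map_measure hFprod.integral_prod_left.aestronglyMeasurable
          hWΩ.aemeasurable).1 hFprod.integral_prod_left

section Past

variable {Ω : Type} {d : ℕ} {u : ℕ → Ω → EuclideanSpace ℝ (Fin d)} {o : ℕ → Ω → ℝ}

lemma comap_sup_comap_le_dcoPast {s t : ℕ} (h : s < t) :
    MeasurableSpace.comap (u s) inferInstance ⊔ MeasurableSpace.comap (o s) inferInstance
      ≤ dcoPast u o t :=
  le_iSup₂_of_le s h le_rfl

lemma measurable_direction_dcoPast {s t : ℕ} (h : s < t) : Measurable[dcoPast u o t] (u s) :=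
  (comap_measurable (u s)).mono (le_sup_left.trans (comap_sup_comap_le_dcoPast h)) le_rfl

lemma measurable_sign_dcoPast {s t : ℕ} (h : s < t) : Measurable[dcoPast u o t] (o s) :=
  (comap_measurable (o s)).mono (le_sup_right.trans (comap_sup_comap_le_dcoPast h)) le_rfl

lemma dcoPast_mono {s t : ℕ} (h : s ≤ t) : dcoPast u o s ≤ dcoPast u o t :=
  iSup₂_le fun _ hr => comap_sup_comap_le_dcoPast (hr.trans_le h)

lemma dcoPast_le [mΩ : MeasurableSpace Ω] (hu : ∀ t, Measurable (u t))
    (ho : ∀ t, Measurable (o t)) (t : ℕ) : dcoPast u o t ≤ mΩ :=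
  iSup₂_le fun s _ => sup_le (hu s).comap_le (ho s).comap_le

end Past

/-- Convergence rate with a linear transfer function `ρ(x) = c_ρ·x`:
with `γ = √(ε/(2β))`, `η = c_ρ·ε^{3/2}/(d·√(2β))`, `T = 2d²βD²/(c_ρ²ε³)`,
`‖w_1 − w*‖ ≤ D`, and the projected updates `w_{t+1} = Π_𝒟(w_t − η·o_t·u_t)` with
`u_t` uniform on the sphere independent of the past and
`E[o_t | past, u_t] = c_ρ·(f(w_t + γu_t) − f(w_t − γu_t))`, we have
`min_{t ∈ [T]} E[f(w_t)] − f(w*) ≤ ε`. -/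
theorem stmt14 (d : ℕ) (hd : 0 < d) (β cρ ε D : ℝ)
    (hβ : 0 < β) (hcρ : 0 < cρ) (hε : 0 < ε) (hD : 0 < D)
    (𝒟 : Set (EuclideanSpace ℝ (Fin d))) (hconv : Convex ℝ 𝒟) (hclosed : IsClosed 𝒟)
    (hbdd : Bornology.IsBounded 𝒟)
    (f : EuclideanSpace ℝ (Fin d) → ℝ)
    (gradf : EuclideanSpace ℝ (Fin d) → EuclideanSpace ℝ (Fin d))
    (hdiff : ∀ x, HasGradientAt f (gradf x) x)
    (hconvf : ∀ x y, ⟪gradf x, y - x⟫ ≤ f y - f x)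
    (hsmooth : ∀ x y, f y ≤ f x + ⟪gradf x, y - x⟫ + β / 2 * ‖y - x‖ ^ 2)
    (wstar : EuclideanSpace ℝ (Fin d)) (hws : wstar ∈ 𝒟)
    (hmin : ∀ v ∈ 𝒟, f wstar ≤ f v)
    (γ η : ℝ) (hγdef : γ = Real.sqrt (ε / (2 * β)))
    (hηdef : η = cρ * ε ^ ((3 : ℝ) / 2) / (d * Real.sqrt (2 * β)))
    (hvalid : ∀ x y : EuclideanSpace ℝ (Fin d),
      (∃ a ∈ 𝒟, ‖x - a‖ ≤ γ) → (∃ b ∈ 𝒟, ‖y - b‖ ≤ γ) → |cρ * (f x - f y)| ≤ 1)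
    (T : ℕ) (hT : (T : ℝ) = 2 * (d : ℝ) ^ 2 * β * D ^ 2 / (cρ ^ 2 * ε ^ 3))
    (proj : EuclideanSpace ℝ (Fin d) → EuclideanSpace ℝ (Fin d))
    (hprojmem : ∀ z, proj z ∈ 𝒟)
    (hproj : ∀ z, ∀ y ∈ 𝒟, ‖proj z - z‖ ≤ ‖y - z‖)
    (μ : Measure (EuclideanSpace ℝ (Fin d))) [IsProbabilityMeasure μ]
    (hsph : ∀ᵐ x ∂μ, ‖x‖ = 1)
    (hrot : ∀ T' : EuclideanSpace ℝ (Fin d) ≃ₗᵢ[ℝ] EuclideanSpace ℝ (Fin d),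
      Measure.map (⇑T') μ = μ)
    (Ω : Type) [MeasurableSpace Ω] (P : Measure Ω) [IsProbabilityMeasure P]
    (u : ℕ → Ω → EuclideanSpace ℝ (Fin d)) (hu : ∀ t, Measurable (u t))
    (hulaw : ∀ t, Measure.map (u t) P = μ)
    (o : ℕ → Ω → ℝ) (ho : ∀ t, Measurable (o t))
    (hosign : ∀ t ω, o t ω = 1 ∨ o t ω = -1)
    (w : ℕ → Ω → EuclideanSpace ℝ (Fin d))
    (w1 : EuclideanSpace ℝ (Fin d)) (hw1mem : w1 ∈ 𝒟) (hw1D : ‖w1 - wstar‖ ≤ D)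
    (hw1 : w 1 = fun _ => w1)
    (hrec : ∀ t, 1 ≤ t → ∀ ω, w (t + 1) ω = proj (w t ω - (η * o t ω) • u t ω))
    (hindep : ∀ t, Indep (MeasurableSpace.comap (u t) inferInstance) (dcoPast u o t) P)
    (hcond : ∀ t, P[o t | dcoPast u o t ⊔ MeasurableSpace.comap (u t) inferInstance]
      =ᵐ[P] fun ω => cρ * (f (w t ω + γ • u t ω) - f (w t ω - γ • u t ω))) :
    ∃ t, 1 ≤ t ∧ t ≤ T ∧ (∫ ω, f (w t ω) ∂P) - f wstar ≤ ε := by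
  have : Nonempty (Fin d) := ⟨⟨0, hd⟩⟩
  have hprojc : Continuous proj := continuous_nearestPoint hconv hprojmem hproj
  have hdpos : (0 : ℝ) < d := Nat.cast_pos.2 hd
  have hγ : 0 < γ := by rw [hγdef]; positivity
  have hη : 0 < η := by rw [hηdef]; positivity
  have hγsq : β * γ ^ 2 = ε / 2 := by
    rw [hγdef, Real.sq_sqrt (by positivity)]; field_simp
  have hε32 : ε ^ ((3 : ℝ) / 2) = ε * Real.sqrt ε := by
    rw [Real.sqrt_eq_rpow, show (3 : ℝ) / 2 = 1 + 1 / 2 by norm_num, Real.rpow_add hε,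
      Real.rpow_one]
  have hηγ : η = cρ * γ * ε / d := by
    rw [hηdef, hγdef, hε32, Real.sqrt_div hε.le]
    field_simp
  have hTη : T * η ^ 2 = D ^ 2 := by
    have h1 : η ^ 2 = cρ ^ 2 * ε ^ 3 / (d ^ 2 * (2 * β)) := by
      have h2 : γ ^ 2 = ε / (2 * β) := by rw [hγdef, Real.sq_sqrt (by positivity)]
      rw [hηγ, div_pow, mul_pow, mul_pow, h2]
      field_simp
    rw [hT, h1]; field_simp
  obtain ⟨C, hC⟩ := hbdd.exists_norm_le
  have hwmem : ∀ t, 1 ≤ t → ∀ ω, w t ω ∈ 𝒟 := by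
    intro t ht ω
    induction t, ht using Nat.le_induction with
    | base => rw [hw1]; exact hw1mem
    | succ t ht _ => rw [hrec t ht]; exact hprojmem _
  have hwmeas : ∀ t, 1 ≤ t → Measurable[dcoPast u o t] (w t) := by
    intro t ht
    induction t, ht using Nat.le_induction with
    | base => rw [hw1]; exact measurable_const
    | succ t ht ih =>
      have h1 : Measurable[dcoPast u o (t + 1)] (w t) :=
        ih.mono (dcoPast_mono t.le_succ) le_rfl
      have h2 : Measurable[dcoPast u o (t + 1)] (u t) := measurable_direction_dcoPast t.lt_succ_self
      have h3 : Measurable[dcoPast u o (t + 1)] (o t) := measurable_sign_dcoPast t.lt_succ_self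
      rw [show w (t + 1) = _ from funext (hrec t ht)]
      exact hprojc.measurable.comp (h1.sub ((h3.const_mul η).smul h2))
  have hpast := dcoPast_le hu ho
  have hone : ∀ t, ∀ᵐ ω ∂P, ‖u t ω‖ = 1 := fun t =>
    ae_of_ae_map (hu t).aemeasurable (by rwa [hulaw t])
  have hoabs : ∀ t ω, |o t ω| = 1 := by
    intro t ω; rcases hosign t ω with h | h <;> simp [h]
  have hoint : ∀ t, Integrable (o t) P := fun t =>
    Integrable.of_bound (ho t).aestronglyMeasurable 1 (.of_forall fun ω => (hoabs t ω).le)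
  have hgain : ∀ t, 1 ≤ t →
      cρ * (2 * γ / d * ((∫ ω, f (w t ω) ∂P) - f wstar - β / 2 * γ ^ 2))
        ≤ ∫ ω, o t ω * ⟪w t ω - wstar, u t ω⟫ ∂P := by
    intro t ht
    have := integral_feedback_mul_inner_ge hsph hrot hβ hdiff hconvf hsmooth hγ hcρ wstar
      (hpast t) (hu t) (hulaw t) (hindep t) (hwmeas t ht) (fun ω => hC _ (hwmem t ht ω))
      (hoint t) (hcond t)
    rwa [finrank_euclideanSpace_fin] at this
  have hdistint : ∀ t, 1 ≤ t → Integrable (fun ω => ‖w t ω - wstar‖ ^ 2) P := fun t ht =>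
    integrable_continuous_comp_of_ae_norm_le ((hwmeas t ht).mono (hpast t) le_rfl)
      (.of_forall fun ω => hC _ (hwmem t ht ω)) (h := fun x => ‖x - wstar‖ ^ 2) (by fun_prop)
  have hcorrint : ∀ t, 1 ≤ t → Integrable (fun ω => o t ω * ⟪w t ω - wstar, u t ω⟫) P := by
    intro t ht
    have hwm : Measurable (w t) := (hwmeas t ht).mono (hpast t) le_rfl
    refine Integrable.of_bound
      ((ho t).mul ((hwm.sub_const wstar).inner (hu t))).aestronglyMeasurable (C + ‖wstar‖) ?_
    filter_upwards [hone t] with ω hω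
    rw [norm_mul, Real.norm_eq_abs, hoabs, one_mul]
    calc ‖⟪w t ω - wstar, u t ω⟫‖ ≤ ‖w t ω - wstar‖ * ‖u t ω‖ := norm_inner_le_norm _ _
      _ ≤ C + ‖wstar‖ := by
        rw [hω, mul_one]
        exact (norm_sub_le _ _).trans (by gcongr; exact hC _ (hwmem t ht ω))
  have hstep : ∀ t, 1 ≤ t → ∫ ω, ‖w (t + 1) ω - wstar‖ ^ 2 ∂P
      ≤ ∫ ω, ‖w t ω - wstar‖ ^ 2 ∂P - 2 * η * ∫ ω, o t ω * ⟪w t ω - wstar, u t ω⟫ ∂P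
        + η ^ 2 := by
    intro t ht
    have hI : Integrable (fun ω => ‖w t ω - wstar‖ ^ 2
        - 2 * η * (o t ω * ⟪w t ω - wstar, u t ω⟫)) P :=
      (hdistint t ht).sub ((hcorrint t ht).const_mul (2 * η))
    calc ∫ ω, ‖w (t + 1) ω - wstar‖ ^ 2 ∂P
        ≤ ∫ ω, (‖w t ω - wstar‖ ^ 2 - 2 * η * (o t ω * ⟪w t ω - wstar, u t ω⟫) + η ^ 2) ∂P := by
          refine integral_mono_ae (hdistint _ (by omega)) (hI.add (integrable_const _)) ?_
          filter_upwards [hone t] with ω hω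
          have h := norm_nearestPoint_step_sq_le hconv hprojmem hproj hws (w t ω) (u t ω)
            (η * o t ω)
          have hsq : (o t ω) ^ 2 = 1 := by rw [← sq_abs, hoabs, one_pow]
          rw [← hrec t ht ω, hω, mul_pow, hsq] at h
          linarith
      _ = _ := by
          rw [integral_add hI (integrable_const _), integral_sub (hdistint t ht)
            ((hcorrint t ht).const_mul _), integral_const_mul]
          simp
  by_contra! hcontra
  have hdecay : ∀ n : ℕ, n ≤ T →
      ∫ ω, ‖w (n + 1) ω - wstar‖ ^ 2 ∂P ≤ D ^ 2 - 2 * n * η ^ 2 := by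
    intro n
    induction n with
    | zero =>
      intro _
      simp only [zero_add, hw1, integral_const, probReal_univ, one_smul]
      have : ‖w1 - wstar‖ ^ 2 ≤ D ^ 2 := by gcongr
      simpa using this
    | succ n ih =>
      intro hn
      have h1 := ih (by omega)
      have h2 := hstep (n + 1) (by omega)
      have h3 := hgain (n + 1) (by omega)
      have h4 := hcontra (n + 1) (by omega) hn
      have h5 : 3 / 2 * η ≤ ∫ ω, o (n + 1) ω * ⟪w (n + 1) ω - wstar, u (n + 1) ω⟫ ∂P := by
        refine le_trans ?_ h3
        calc 3 / 2 * η = cρ * (2 * γ / d * (3 / 4 * ε)) := by rw [hηγ]; ring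
          _ ≤ _ := by gcongr; linarith
      have h6 := mul_le_mul_of_nonneg_left h5 (by positivity : 0 ≤ 2 * η)
      push_cast
      nlinarith
  have hlast := hdecay T le_rfl
  have hnonneg : 0 ≤ ∫ ω, ‖w (T + 1) ω - wstar‖ ^ 2 ∂P := integral_nonneg fun ω => by positivity
  have : 0 < D ^ 2 := by positivity
  linarith
end
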